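/- Let {v_i}_{i∈I} be the set of minimal scalings of a scalable unit-norm frame F = {f_i}_{i=1}^k in ℝ^n, and suppose {v_i}_{i∈I} is affinely independent. Then for any two strict scalings c₁ and c₂ of F, the empty covers of the scaled frames coincide: EC(c₁F) = EC(c₂F); moreover, the elements of EC(c₁F) are pairwise disjoint. -/

import Mathlib

open Finset

/-- `c` is a scaling of the unit-norm frame `f`:
`c` is entrywise nonnegative and `∑ c i • f_i f_iᵗ = I`. -/
def IsScaling {n k : ℕ} (f : Fin k → Fin n → ℝ) (c : Fin k → ℝ) : Prop :=
  (∀ i, 0 ≤ c i) ∧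
    ∑ i, c i • Matrix.vecMulVec (f i) (f i) = (1 : Matrix (Fin n) (Fin n) ℝ)

/-- The support of a vector `c ∈ ℝᵏ`. -/
noncomputable def suppF {k : ℕ} (c : Fin k → ℝ) : Finset (Fin k) :=
  Finset.univ.filter (fun i => c i ≠ 0)

/-- `c` is a minimal scaling of `f`: it is a scaling and `{f_i : c i > 0}` has no
proper scalable subframe. -/
def IsMinimalScaling {n k : ℕ} (f : Fin k → Fin n → ℝ) (c : Fin k → ℝ) : Prop :=
  IsScaling f c ∧
    ∀ S : Finset (Fin k), S ⊂ suppF c →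
      ¬ ∃ d : Fin k → ℝ, (∀ i, 0 ≤ d i) ∧ (∀ i, i ∉ S → d i = 0) ∧
        ∑ i, d i • Matrix.vecMulVec (f i) (f i) = (1 : Matrix (Fin n) (Fin n) ℝ)

/-- `f` is a unit-norm frame for `ℝⁿ`: a finite spanning family of unit vectors. -/
def IsUnitNormFrame {n k : ℕ} (f : Fin k → Fin n → ℝ) : Prop :=
  (∀ i, ∑ l, f i l ^ 2 = 1) ∧ Submodule.span ℝ (Set.range f) = ⊤
/-- The factor poset of a finite family `g` of vectors in `ℝⁿ`: all index sets `J`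
such that `{g j}_{j ∈ J}` is a tight frame for `ℝⁿ`, together with `∅`. -/
def FactorPoset {n k : ℕ} (g : Fin k → Fin n → ℝ) : Set (Finset (Fin k)) :=
  {J | ∃ A : ℝ, 0 < A ∧ ∀ x : Fin n → ℝ,
      ∑ j ∈ J, (∑ l, x l * g j l) ^ 2 = A * ∑ l, x l ^ 2} ∪ {∅}

/-- The empty cover of `g`: the minimal nonempty elements of the factor poset. -/
def EmptyCover {n k : ℕ} (g : Fin k → Fin n → ℝ) : Set (Finset (Fin k)) :=
  {J | J ∈ FactorPoset g ∧ J ≠ ∅ ∧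
    ¬ ∃ J' : Finset (Fin k), J' ∈ FactorPoset g ∧ J' ≠ ∅ ∧ J' ⊂ J}

/-- The scaled frame `cF = {√c(i) f_i}`. -/
noncomputable def scaledVec {n k : ℕ} (f : Fin k → Fin n → ℝ) (c : Fin k → ℝ) :
    Fin k → Fin n → ℝ := fun i => Real.sqrt (c i) • f i

section ScalingCone

variable {n k m : ℕ}

/-- The linear map sending a weight vector `c` to the weighted frame operator
`∑ c i • f_i f_iᵗ`. -/
noncomputable def frameOperator (f : Fin k → Fin n → ℝ) :
    (Fin k → ℝ) →ₗ[ℝ] Matrix (Fin n) (Fin n) ℝ :=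
  Fintype.linearCombination ℝ (fun i => Matrix.vecMulVec (f i) (f i))

/-- The cone of nonnegative weights whose frame operator is a multiple of the identity. -/
def IsTightWeight (f : Fin k → Fin n → ℝ) (c : Fin k → ℝ) : Prop :=
  (∀ i, 0 ≤ c i) ∧ ∃ A : ℝ, frameOperator f c = A • (1 : Matrix (Fin n) (Fin n) ℝ)

theorem mem_suppF {c : Fin k → ℝ} {i : Fin k} : i ∈ suppF c ↔ c i ≠ 0 := by
  simp [suppF]

theorem frameOperator_apply (f : Fin k → Fin n → ℝ) (c : Fin k → ℝ) :
    frameOperator f c = ∑ i, c i • Matrix.vecMulVec (f i) (f i) :=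
  rfl

theorem isScaling_iff {f : Fin k → Fin n → ℝ} {c : Fin k → ℝ} :
    IsScaling f c ↔ (∀ i, 0 ≤ c i) ∧ frameOperator f c = 1 :=
  Iff.rfl

theorem IsScaling.isTightWeight {f : Fin k → Fin n → ℝ} {c : Fin k → ℝ}
    (hc : IsScaling f c) : IsTightWeight f c :=
  ⟨hc.1, 1, by rw [one_smul]; exact hc.2⟩

theorem trace_frameOperator {f : Fin k → Fin n → ℝ} (hf : ∀ i, ∑ l, f i l ^ 2 = 1)
    (c : Fin k → ℝ) : (frameOperator f c).trace = ∑ i, c i := by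
  rw [frameOperator_apply, Matrix.trace_sum]
  refine Finset.sum_congr rfl fun i _ => ?_
  have h : f i ⬝ᵥ f i = 1 := by
    rw [← hf i]
    exact Finset.sum_congr rfl fun l _ => (sq (f i l)).symm
  rw [Matrix.trace_smul, Matrix.trace_vecMulVec, h, smul_eq_mul, mul_one]

theorem sum_eq_mul_of_frameOperator_eq_smul_one {f : Fin k → Fin n → ℝ}
    (hf : ∀ i, ∑ l, f i l ^ 2 = 1) {c : Fin k → ℝ} {A : ℝ}
    (h : frameOperator f c = A • (1 : Matrix (Fin n) (Fin n) ℝ)) : ∑ i, c i = A * n := by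
  rw [← trace_frameOperator hf, h, Matrix.trace_smul, Matrix.trace_one, Fintype.card_fin,
    smul_eq_mul]

theorem pos_of_frameOperator_eq_smul_one {f : Fin k → Fin n → ℝ}
    (hf : ∀ i, ∑ l, f i l ^ 2 = 1) {c : Fin k → ℝ} (hc : ∀ i, 0 ≤ c i) (hc0 : c ≠ 0) {A : ℝ}
    (h : frameOperator f c = A • (1 : Matrix (Fin n) (Fin n) ℝ)) : 0 < A := by
  have hs := sum_eq_mul_of_frameOperator_eq_smul_one hf h
  have hpos : 0 < ∑ i, c i := by
    obtain ⟨i, hi⟩ := Function.ne_iff.mp hc0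
    exact Finset.sum_pos' (fun i _ => hc i)
      ⟨i, Finset.mem_univ i, lt_of_le_of_ne (hc i) (Ne.symm hi)⟩
  rw [hs] at hpos
  exact pos_of_mul_pos_left hpos (Nat.cast_nonneg n)

theorem exists_isMinimalScaling_suppF_subset {f : Fin k → Fin n → ℝ}
    (hf : ∀ i, ∑ l, f i l ^ 2 = 1) {c : Fin k → ℝ} (hc : IsTightWeight f c) (hc0 : c ≠ 0) :
    ∃ d, IsMinimalScaling f d ∧ suppF d ⊆ suppF c := by
  obtain ⟨hnn, A, hA⟩ := hc
  have hApos := pos_of_frameOperator_eq_smul_one hf hnn hc0 hA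
  have hne : {d : Fin k → ℝ | IsScaling f d ∧ suppF d ⊆ suppF c}.Nonempty := by
    refine ⟨A⁻¹ • c, isScaling_iff.mpr ⟨fun i => ?_, ?_⟩, fun i hi => ?_⟩
    · exact mul_nonneg (inv_nonneg.mpr hApos.le) (hnn i)
    · rw [map_smul, hA, smul_smul, inv_mul_cancel₀ hApos.ne', one_smul]
    · rw [mem_suppF] at hi ⊢
      exact right_ne_zero_of_mul hi
  obtain ⟨d, ⟨hd, hdc⟩, hmin⟩ := exists_minimalFor_of_wellFoundedLT _
    (fun d : Fin k → ℝ => (suppF d).card) hne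
  refine ⟨d, ⟨hd, ?_⟩, hdc⟩
  rintro S hS ⟨e, he, heS, hsum⟩
  have hes : suppF e ⊆ S := fun i hi => by
    by_contra hiS
    exact mem_suppF.mp hi (heS i hiS)
  have hlt := Finset.card_lt_card (lt_of_le_of_lt hes hS)
  exact absurd (hmin (j := e) ⟨⟨he, hsum⟩, (hes.trans hS.1).trans hdc⟩ hlt.le) (not_le.mpr hlt)

theorem exists_pos_smul_le {c d : Fin k → ℝ} (hc : ∀ i, 0 ≤ c i) (hd : ∀ i, 0 ≤ d i)
    (hd0 : d ≠ 0) (hdc : suppF d ⊆ suppF c) :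
    ∃ t : ℝ, 0 < t ∧ (∀ i, 0 ≤ (c - t • d) i) ∧ suppF (c - t • d) ⊂ suppF c := by
  obtain ⟨i₀, hi₀⟩ := Function.ne_iff.mp hd0
  obtain ⟨j, hj, hmin⟩ := Finset.exists_min_image (suppF d) (fun i => c i / d i)
    ⟨i₀, mem_suppF.mpr hi₀⟩
  have hpos : ∀ i ∈ suppF d, 0 < d i := fun i hi =>
    lt_of_le_of_ne (hd i) (Ne.symm (mem_suppF.mp hi))
  have hcj : 0 < c j := lt_of_le_of_ne (hc j) (Ne.symm (mem_suppF.mp (hdc hj)))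
  refine ⟨c j / d j, div_pos hcj (hpos j hj), fun i => ?_, ?_⟩
  · rw [Pi.sub_apply, Pi.smul_apply, smul_eq_mul, sub_nonneg]
    by_cases hi : i ∈ suppF d
    · exact (le_div_iff₀ (hpos i hi)).mp (hmin i hi)
    · rw [mem_suppF, not_not] at hi
      rw [hi, mul_zero]
      exact hc i
  · refine (Finset.ssubset_iff_of_subset fun i hi => ?_).mpr ⟨j, hdc hj, ?_⟩
    · by_contra hic
      have hid : i ∉ suppF d := fun h => hic (hdc h)
      rw [mem_suppF, not_not] at hic hid
      exact mem_suppF.mp hi (by simp [hic, hid])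
    · rw [mem_suppF, not_not, Pi.sub_apply, Pi.smul_apply, smul_eq_mul,
        div_mul_cancel₀ _ (hpos j hj).ne', sub_self]

theorem IsTightWeight.sub_smul {f : Fin k → Fin n → ℝ} {c d : Fin k → ℝ} {t : ℝ}
    (hc : IsTightWeight f c) (hd : IsScaling f d) (h : ∀ i, 0 ≤ (c - t • d) i) :
    IsTightWeight f (c - t • d) := by
  obtain ⟨-, A, hA⟩ := hc
  exact ⟨h, A - t, by rw [map_sub, map_smul, hA, (isScaling_iff.mp hd).2, _root_.sub_smul]⟩

theorem IsScaling.ne_zero {f : Fin k → Fin n → ℝ} (hn : n ≠ 0) {c : Fin k → ℝ}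
    (hc : IsScaling f c) : c ≠ 0 := by
  rintro rfl
  have : Nonempty (Fin n) := ⟨⟨0, Nat.pos_of_ne_zero hn⟩⟩
  have h := (isScaling_iff.mp hc).2
  rw [map_zero] at h
  exact zero_ne_one h

/-- Every tight weight is a conic combination of minimal scalings. -/
theorem IsTightWeight.exists_eq_sum {f : Fin k → Fin n → ℝ} (hn : n ≠ 0)
    (hf : ∀ i, ∑ l, f i l ^ 2 = 1) {v : Fin m → Fin k → ℝ}
    (hv : Set.range v = {c | IsMinimalScaling f c}) {c : Fin k → ℝ} (hc : IsTightWeight f c) :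
    ∃ a : Fin m → ℝ, (∀ i, 0 ≤ a i) ∧ c = ∑ i, a i • v i := by
  induction hN : (suppF c).card using Nat.strong_induction_on generalizing c with
  | _ N ih =>
    by_cases hc0 : c = 0
    · exact ⟨0, fun _ => le_rfl, by simp [hc0]⟩
    obtain ⟨d, hd, hdc⟩ := exists_isMinimalScaling_suppF_subset hf hc hc0
    obtain ⟨j, rfl⟩ : d ∈ Set.range v := hv ▸ hd
    obtain ⟨t, ht, hnn, hlt⟩ := exists_pos_smul_le hc.1 hd.1.1 (hd.1.ne_zero hn) hdc
    obtain ⟨a, ha, hsum⟩ := ih _ (hN ▸ Finset.card_lt_card hlt) (hc.sub_smul hd.1 hnn) rfl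
    refine ⟨a + Pi.single j t, fun i => add_nonneg (ha i) ?_, ?_⟩
    · by_cases hij : i = j
      · subst hij; simpa using ht.le
      · simp [hij]
    · simp only [Pi.add_apply, add_smul, Finset.sum_add_distrib, ← hsum]
      simp [Pi.single_apply, ite_smul]

/-- If the minimal scalings are affinely independent, they are linearly independent. -/
theorem linearIndependent_of_affine {f : Fin k → Fin n → ℝ} (hn : n ≠ 0)
    {v : Fin m → Fin k → ℝ} (hv : ∀ i, IsScaling f (v i))
    (haff : ∀ α : Fin m → ℝ, ∑ i, α i • v i = 0 → ∑ i, α i = 0 → ∀ i, α i = 0) :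
    LinearIndependent ℝ v := by
  rw [Fintype.linearIndependent_iff]
  intro α hα
  refine haff α hα ?_
  have : Nonempty (Fin n) := ⟨⟨0, Nat.pos_of_ne_zero hn⟩⟩
  have h := congrArg (frameOperator f) hα
  simp only [map_sum, map_smul, (isScaling_iff.mp (hv _)).2, map_zero, ← Finset.sum_smul] at h
  exact (smul_eq_zero.mp h).resolve_right one_ne_zero

/-- A strict scaling is a conic combination of the minimal scalings, with positive coefficient
at any prescribed minimal scaling. -/
theorem IsScaling.exists_eq_sum_pos {f : Fin k → Fin n → ℝ} (hn : n ≠ 0)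
    (hf : ∀ i, ∑ l, f i l ^ 2 = 1) {v : Fin m → Fin k → ℝ}
    (hv : Set.range v = {c | IsMinimalScaling f c}) {c : Fin k → ℝ} (hc : IsScaling f c)
    (hstrict : ∀ l, c l ≠ 0) (j : Fin m) :
    ∃ a : Fin m → ℝ, 0 < a j ∧ c = ∑ i, a i • v i := by
  have hj : IsMinimalScaling f (v j) := by
    have : v j ∈ {c | IsMinimalScaling f c} := hv ▸ Set.mem_range_self j
    exact this
  obtain ⟨t, ht, hnn, -⟩ := exists_pos_smul_le hc.1 hj.1.1 (hj.1.ne_zero hn)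
    (fun i _ => mem_suppF.mpr (hstrict i))
  obtain ⟨a, ha, hsum⟩ := (hc.isTightWeight.sub_smul hj.1 hnn).exists_eq_sum hn hf hv
  refine ⟨a + Pi.single j t, ?_, ?_⟩
  · simpa using add_pos_of_nonneg_of_pos (ha j) ht
  · simp only [Pi.add_apply, add_smul, Finset.sum_add_distrib, ← hsum]
    simp [Pi.single_apply, ite_smul]

theorem Matrix.eq_zero_of_isSymm_of_dotProduct_mulVec_self {M : Matrix (Fin n) (Fin n) ℝ}
    (hM : M.IsSymm) (h : ∀ x, x ⬝ᵥ M.mulVec x = 0) : M = 0 := by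
  ext a b
  have h1 := h (Pi.single a 1 + Pi.single b 1)
  have ha := h (Pi.single a 1)
  have hb := h (Pi.single b 1)
  have hab := hM.apply a b
  simp [Matrix.mulVec_add] at h1 ha hb
  rw [Matrix.zero_apply]
  linarith

theorem frameOperator_isSymm (f : Fin k → Fin n → ℝ) (c : Fin k → ℝ) :
    (frameOperator f c).IsSymm := by
  rw [frameOperator_apply, Matrix.IsSymm, Matrix.transpose_sum]
  simp [Matrix.transpose_vecMulVec]

theorem sum_sq_scaledVec (f : Fin k → Fin n → ℝ) {c : Fin k → ℝ} (hc : ∀ i, 0 ≤ c i)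
    (J : Finset (Fin k)) (x : Fin n → ℝ) :
    ∑ j ∈ J, (∑ l, x l * scaledVec f c j l) ^ 2 =
      x ⬝ᵥ (frameOperator f ((J : Set (Fin k)).indicator c)).mulVec x := by
  classical
  rw [frameOperator_apply, Matrix.sum_mulVec, dotProduct_sum,
    ← Finset.sum_subset (Finset.subset_univ J)]
  · refine Finset.sum_congr rfl fun j hj => ?_
    have h : ∑ l, x l * scaledVec f c j l = √(c j) * (x ⬝ᵥ f j) := by
      simp only [scaledVec, Pi.smul_apply, smul_eq_mul, dotProduct, Finset.mul_sum]
      exact Finset.sum_congr rfl fun l _ => by ring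
    rw [h, mul_pow, Real.sq_sqrt (hc j), Set.indicator_of_mem (by simpa using hj),
      Matrix.smul_mulVec, dotProduct_smul, Matrix.vecMulVec_mulVec, smul_eq_mul]
    simp only [op_smul_eq_smul, dotProduct_smul, smul_eq_mul]
    rw [dotProduct_comm (f j) x]
    ring
  · intro j _ hj
    rw [Set.indicator_of_notMem (by simpa using hj), zero_smul, Matrix.zero_mulVec,
      dotProduct_zero]

theorem forall_sum_sq_scaledVec_iff (f : Fin k → Fin n → ℝ) {c : Fin k → ℝ}
    (hc : ∀ i, 0 ≤ c i) (J : Finset (Fin k)) (A : ℝ) :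
    (∀ x : Fin n → ℝ, ∑ j ∈ J, (∑ l, x l * scaledVec f c j l) ^ 2 = A * ∑ l, x l ^ 2) ↔
      frameOperator f ((J : Set (Fin k)).indicator c) =
        A • (1 : Matrix (Fin n) (Fin n) ℝ) := by
  have hA : ∀ x : Fin n → ℝ, A * ∑ l, x l ^ 2 =
      x ⬝ᵥ (A • (1 : Matrix (Fin n) (Fin n) ℝ)).mulVec x := fun x => by
    rw [Matrix.smul_mulVec, Matrix.one_mulVec, dotProduct_smul, smul_eq_mul]
    simp only [dotProduct, sq]
  simp only [sum_sq_scaledVec f hc, hA]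
  refine ⟨fun h => sub_eq_zero.mp ?_, fun h x => by rw [h]⟩
  refine Matrix.eq_zero_of_isSymm_of_dotProduct_mulVec_self
    ((frameOperator_isSymm f _).sub (Matrix.isSymm_one.smul A)) fun x => ?_
  rw [Matrix.sub_mulVec, dotProduct_sub, h, sub_self]

theorem mem_factorPoset_scaledVec_iff {f : Fin k → Fin n → ℝ} (hf : ∀ i, ∑ l, f i l ^ 2 = 1)
    {c : Fin k → ℝ} (hc : ∀ i, 0 ≤ c i) (hstrict : ∀ l, c l ≠ 0) {J : Finset (Fin k)} :
    J ∈ FactorPoset (scaledVec f c) ↔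
      IsTightWeight f ((J : Set (Fin k)).indicator c) := by
  have hnn : ∀ i, 0 ≤ (J : Set (Fin k)).indicator c i := fun i =>
    Set.indicator_nonneg (fun i _ => hc i) i
  simp only [FactorPoset, Set.mem_union, Set.mem_ofPred_eq, Set.mem_singleton_iff,
    forall_sum_sq_scaledVec_iff f hc]
  constructor
  · rintro (⟨A, -, h⟩ | rfl)
    · exact ⟨hnn, A, h⟩
    · exact ⟨hnn, 0, by rw [Finset.coe_empty, Set.indicator_empty', map_zero, zero_smul]⟩
  · rintro ⟨-, A, h⟩
    refine or_iff_not_imp_right.mpr fun hJ => ⟨A, ?_, h⟩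
    obtain ⟨j, hj⟩ := Finset.nonempty_iff_ne_empty.mpr hJ
    refine pos_of_frameOperator_eq_smul_one hf hnn (Function.ne_iff.mpr ⟨j, ?_⟩) h
    simpa [hj] using hstrict j

theorem apply_eq_zero_of_sum_smul_apply_eq_zero {a : Fin m → ℝ}
    {v : Fin m → Fin k → ℝ} (ha : ∀ i, 0 ≤ a i)
    (hv : ∀ i l, 0 ≤ v i l) {j : Fin m} (hj : a j ≠ 0) {l : Fin k}
    (hl : (∑ i, a i • v i) l = 0) : v j l = 0 := by
  simp only [Finset.sum_apply, Pi.smul_apply, smul_eq_mul] at hl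
  rw [Finset.sum_eq_zero_iff_of_nonneg fun i _ => mul_nonneg (ha i) (hv i l)] at hl
  exact (mul_eq_zero.mp (hl j (Finset.mem_univ j))).resolve_left hj

/-- When the minimal scalings are independent, the factor poset of a strictly scaled frame
consists of the index sets which do not split the support of any minimal scaling. -/
theorem mem_factorPoset_iff_forall_suppF {f : Fin k → Fin n → ℝ} (hn : n ≠ 0)
    (hf : ∀ i, ∑ l, f i l ^ 2 = 1) {v : Fin m → Fin k → ℝ}
    (hv : Set.range v = {c | IsMinimalScaling f c}) (hli : LinearIndependent ℝ v)
    {c : Fin k → ℝ} (hc : IsScaling f c) (hstrict : ∀ l, c l ≠ 0) {J : Finset (Fin k)} :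
    J ∈ FactorPoset (scaledVec f c) ↔ ∀ i, suppF (v i) ⊆ J ∨ Disjoint (suppF (v i)) J := by
  classical
  have hvs : ∀ i, IsScaling f (v i) := fun i => by
    have : v i ∈ {c | IsMinimalScaling f c} := hv ▸ Set.mem_range_self i
    exact this.1
  have hnn : ∀ s : Set (Fin k), ∀ i, 0 ≤ s.indicator c i := fun s i =>
    Set.indicator_nonneg (fun i _ => hc.1 i) i
  rw [mem_factorPoset_scaledVec_iff hf hc.1 hstrict]
  constructor
  · intro hJ j
    have hsplit := Set.indicator_self_add_compl (J : Set (Fin k)) c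
    have hJc : IsTightWeight f ((J : Set (Fin k))ᶜ.indicator c) := by
      obtain ⟨-, A, hA⟩ := hJ
      refine ⟨hnn _, 1 - A, ?_⟩
      rw [← eq_sub_iff_add_eq'] at hsplit
      rw [hsplit, map_sub, hA, (isScaling_iff.mp hc).2, sub_smul, one_smul]
    obtain ⟨p, hp, hpJ⟩ := hJ.exists_eq_sum hn hf hv
    obtain ⟨q, hq, hqJ⟩ := hJc.exists_eq_sum hn hf hv
    obtain ⟨a, ha, hac⟩ := hc.exists_eq_sum_pos hn hf hv hstrict j
    have hapq : a j = (p + q) j := by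
      refine congrFun (hli.fintypeLinearCombination_injective ?_) j
      simp only [Fintype.linearCombination_apply, Pi.add_apply, add_smul,
        Finset.sum_add_distrib, ← hac, ← hpJ, ← hqJ, hsplit]
    by_cases hpj : p j = 0
    · have hqj : q j ≠ 0 := fun h => ha.ne' (by rw [hapq, Pi.add_apply, hpj, h, add_zero])
      refine Or.inr (Finset.disjoint_left.mpr fun l hl hlJ => mem_suppF.mp hl ?_)
      refine apply_eq_zero_of_sum_smul_apply_eq_zero hq (fun i => (hvs i).1) hqj ?_
      rw [← hqJ, Set.indicator_of_notMem (by simpa using hlJ)]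
    · refine Or.inl fun l hl => ?_
      by_contra hlJ
      refine mem_suppF.mp hl (apply_eq_zero_of_sum_smul_apply_eq_zero hp (fun i => (hvs i).1) hpj ?_)
      rw [← hpJ, Set.indicator_of_notMem (by simpa using hlJ)]
  · intro h
    obtain ⟨a, -, hac⟩ := hc.isTightWeight.exists_eq_sum hn hf hv
    have hJ : (J : Set (Fin k)).indicator c =
        ∑ i, (if suppF (v i) ⊆ J then a i else 0) • v i := by
      ext l
      by_cases hl : l ∈ J
      · rw [Set.indicator_of_mem (by simpa using hl), hac, Finset.sum_apply, Finset.sum_apply]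
        refine Finset.sum_congr rfl fun i _ => ?_
        split_ifs with hi
        · rfl
        · have h0 := Finset.disjoint_right.mp ((h i).resolve_left hi) hl
          rw [mem_suppF, not_not] at h0
          simp [h0]
      · rw [Set.indicator_of_notMem (by simpa using hl), Finset.sum_apply]
        refine (Finset.sum_eq_zero fun i _ => ?_).symm
        split_ifs with hi
        · have h0 : l ∉ suppF (v i) := fun h' => hl (hi h')
          rw [mem_suppF, not_not] at h0
          simp [h0]
        · simp
    refine ⟨hnn _, ∑ i, if suppF (v i) ⊆ J then a i else 0, ?_⟩
    rw [hJ]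
    simp only [map_sum, map_smul, (isScaling_iff.mp (hvs _)).2, ← Finset.sum_smul]

theorem disjoint_of_mem_emptyCover {g : Fin k → Fin n → ℝ}
    (hinter : ∀ J₁ ∈ FactorPoset g, ∀ J₂ ∈ FactorPoset g, J₁ ∩ J₂ ∈ FactorPoset g)
    {E₁ E₂ : Finset (Fin k)} (h₁ : E₁ ∈ EmptyCover g) (h₂ : E₂ ∈ EmptyCover g)
    (hne : E₁ ≠ E₂) : Disjoint E₁ E₂ := by
  rw [Finset.disjoint_iff_inter_eq_empty]
  by_contra hE
  have hmem := hinter E₁ h₁.1 E₂ h₂.1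
  have eq₁ : E₁ ∩ E₂ = E₁ := by
    by_contra h
    exact h₁.2.2 ⟨_, hmem, hE, Finset.inter_subset_left.ssubset_of_ne h⟩
  have eq₂ : E₁ ∩ E₂ = E₂ := by
    by_contra h
    exact h₂.2.2 ⟨_, hmem, hE, Finset.inter_subset_right.ssubset_of_ne h⟩
  exact hne (eq₁.symm.trans eq₂)

end ScalingCone

/-- If the minimal scalings of a scalable unit-norm frame `F` are affinely
independent, then any two strict scalings `c₁, c₂` yield scaled frames with the
same empty cover, and the elements of this empty cover are pairwise disjoint. -/
theorem strict_scalings_same_emptyCover (n k m : ℕ)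
    (f : Fin k → Fin n → ℝ) (hF : IsUnitNormFrame f)
    (v : Fin m → Fin k → ℝ) (hvinj : Function.Injective v)
    (hrange : Set.range v = {c : Fin k → ℝ | IsMinimalScaling f c})
    (haffind : ∀ α : Fin m → ℝ,
      ∑ i, α i • v i = 0 → ∑ i, α i = 0 → ∀ i, α i = 0)
    (c₁ c₂ : Fin k → ℝ) (hc₁ : IsScaling f c₁) (hc₂ : IsScaling f c₂)
    (hstrict₁ : ∀ l, c₁ l ≠ 0) (hstrict₂ : ∀ l, c₂ l ≠ 0) :
    EmptyCover (scaledVec f c₁) = EmptyCover (scaledVec f c₂) ∧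
      ∀ E₁ ∈ EmptyCover (scaledVec f c₁), ∀ E₂ ∈ EmptyCover (scaledVec f c₁),
        E₁ ≠ E₂ → Disjoint E₁ E₂ := by
  rcases eq_or_ne n 0 with rfl | hn
  · have hk : IsEmpty (Fin k) := ⟨fun i => by simpa using hF.1 i⟩
    have hE : ∀ c : Fin k → ℝ, EmptyCover (scaledVec f c) = ∅ := fun c =>
      Set.eq_empty_of_forall_notMem fun J hJ => hJ.2.1 (Finset.eq_empty_of_isEmpty J)
    simp [hE]
  have hvs : ∀ i, IsScaling f (v i) := fun i => by
    have : v i ∈ {c | IsMinimalScaling f c} := hrange ▸ Set.mem_range_self i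
    exact this.1
  have hli := linearIndependent_of_affine hn hvs haffind
  have hfp : FactorPoset (scaledVec f c₁) = FactorPoset (scaledVec f c₂) := by
    ext J
    rw [mem_factorPoset_iff_forall_suppF hn hF.1 hrange hli hc₁ hstrict₁,
      mem_factorPoset_iff_forall_suppF hn hF.1 hrange hli hc₂ hstrict₂]
  refine ⟨by rw [EmptyCover, EmptyCover, hfp], fun E₁ h₁ E₂ h₂ =>
    disjoint_of_mem_emptyCover ?_ h₁ h₂⟩
  simp only [mem_factorPoset_iff_forall_suppF hn hF.1 hrange hli hc₁ hstrict₁]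
  intro J₁ hJ₁ J₂ hJ₂ i
  rcases hJ₁ i with h | h
  · rcases hJ₂ i with h' | h'
    · exact Or.inl (Finset.subset_inter h h')
    · exact Or.inr (h'.mono_right Finset.inter_subset_right)
  · exact Or.inr (h.mono_right Finset.inter_subset_left)
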